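/- arXiv:1806.08821 — 4 statements merged into one kernel-verified Lean document; each statement's English description precedes it below -/
import Mathlib

section
/- Let (Ω, μ) be a measure space, let F be a μ-integrable function on Ω, let E ⊆ Ω be measurable, and let q : Ω → ℝ be measurable with 0 ≤ q ≤ 1 μ-a.e. Assume that q · F⁺ = F · 1_E μ-a.e. (where F⁺ = max(F,0)) and that ∫_S F dμ ≠ 0 for every measurable S ⊆ Ω with μ(S) > 0. Then 1_E ≤ q μ-a.e.; more precisely, q = 1_E μ-a.e. on the set {F > 0} and μ(E ∩ {F ≤ 0}) = 0. -/
open MeasureTheory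

/-- A function whose integral over every measurable set of positive measure is nonzero
is nonzero almost everywhere. -/
theorem ae_ne_zero_of_forall_setIntegral_ne_zero
    {Ω : Type*} [MeasurableSpace Ω] {μ : Measure Ω}
    {F : Ω → ℝ} (hF : AEStronglyMeasurable F μ)
    (hnd : ∀ S : Set Ω, MeasurableSet S → 0 < μ S → ∫ x in S, F x ∂μ ≠ 0) :
    ∀ᵐ x ∂μ, F x ≠ 0 := by
  have hS : MeasurableSet {x | hF.mk F x = 0} :=
    hF.stronglyMeasurable_mk.measurable (measurableSet_singleton 0)
  have hint : ∫ x in {x | hF.mk F x = 0}, F x ∂μ = 0 := by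
    rw [setIntegral_congr_ae hS (hF.ae_eq_mk.mono fun x hx _ => hx)]
    exact setIntegral_eq_zero_of_forall_eq_zero fun x hx => hx
  have hzero : μ {x | hF.mk F x = 0} = 0 := by
    by_contra h
    exact hnd _ hS (pos_iff_ne_zero.mpr h) hint
  have hmk : ∀ᵐ x ∂μ, hF.mk F x ≠ 0 := by simpa [ae_iff] using hzero
  filter_upwards [hF.ae_eq_mk, hmk] with x hx hne
  rwa [hx]

/-- If `0 ≤ q ≤ 1` a.e., `q · F⁺ = F · 1_E` a.e., and `∫_S F ≠ 0` for
every measurable `S` of positive measure, then `1_E ≤ q` a.e.; more precisely `q = 1_E`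
a.e. on `{F > 0}` and `μ(E ∩ {F ≤ 0}) = 0`. -/
theorem indicator_le_of_mul_posPart_eq_indicator
    {Ω : Type*} [MeasurableSpace Ω] (μ : Measure Ω)
    (F : Ω → ℝ) (hF : Integrable F μ)
    (E : Set Ω) (hE : MeasurableSet E)
    (q : Ω → ℝ) (hq : Measurable q)
    (hq01 : ∀ᵐ x ∂μ, 0 ≤ q x ∧ q x ≤ 1)
    (hid : ∀ᵐ x ∂μ, q x * max (F x) 0 = F x * E.indicator (fun _ => (1 : ℝ)) x)
    (hnd : ∀ S : Set Ω, MeasurableSet S → 0 < μ S → ∫ x in S, F x ∂μ ≠ 0) :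
    (∀ᵐ x ∂μ, E.indicator (fun _ => (1 : ℝ)) x ≤ q x) ∧
    (∀ᵐ x ∂μ, 0 < F x → q x = E.indicator (fun _ => (1 : ℝ)) x) ∧
    μ (E ∩ {x | F x ≤ 0}) = 0 := by
  have hne := ae_ne_zero_of_forall_setIntegral_ne_zero hF.aestronglyMeasurable hnd
  have hpos : ∀ᵐ x ∂μ, 0 < F x → q x = E.indicator (fun _ => (1 : ℝ)) x := by
    filter_upwards [hid] with x hx h
    rw [max_eq_left h.le, mul_comm] at hx
    exact mul_left_cancel₀ h.ne' hx
  have hE_pos : ∀ᵐ x ∂μ, x ∈ E → 0 < F x := by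
    filter_upwards [hid, hne] with x hx h hxE
    by_contra! hle
    rw [max_eq_right hle, Set.indicator_of_mem hxE, mul_zero, mul_one] at hx
    exact h hx.symm
  refine ⟨?_, hpos, ?_⟩
  · filter_upwards [hq01, hpos, hE_pos] with x h01 hx hxE
    by_cases h : x ∈ E
    · exact (hx (hxE h)).ge
    · simpa [h] using h01.1
  · rw [measure_eq_zero_iff_ae_notMem]
    filter_upwards [hE_pos] with x hx h
    exact (hx h.1).not_ge h.2
end

section
/- Let n ≥ 1 and let φ : [0, ∞) → [0, ∞) be strictly increasing with φ(0) = 0. Define a : ℝⁿ → ℝⁿ by a(ξ) = φ(|ξ|) ξ / |ξ| for ξ ≠ 0 and a(0) = 0, where |·| is the Euclidean norm. Then a is strictly monotone: (a(ξ) − a(η)) · (ξ − η) > 0 for all ξ, η ∈ ℝⁿ with ξ ≠ η, where · denotes the Euclidean inner product. -/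
/-- A radial vector field `a(ξ) = φ(|ξ|) ξ/|ξ|` (with `a 0 = 0`),
where `φ : [0,∞) → [0,∞)` is strictly increasing with `φ(0) = 0`, is strictly
monotone on `ℝⁿ`. -/
theorem radial_strictMonotone
    (n : ℕ) (hn : 1 ≤ n) (φ : ℝ → ℝ)
    (hφmono : StrictMonoOn φ (Set.Ici 0))
    (hφnonneg : ∀ t, 0 ≤ t → 0 ≤ φ t)
    (hφ0 : φ 0 = 0)
    (a : EuclideanSpace ℝ (Fin n) → EuclideanSpace ℝ (Fin n))
    (ha₀ : a 0 = 0)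
    (ha : ∀ ξ : EuclideanSpace ℝ (Fin n), ξ ≠ 0 → a ξ = (φ ‖ξ‖ / ‖ξ‖) • ξ) :
    ∀ ξ η : EuclideanSpace ℝ (Fin n), ξ ≠ η →
      0 < inner (𝕜 := ℝ) (a ξ - a η) (ξ - η) := by
  have ha' : ∀ ξ, a ξ = (φ ‖ξ‖ / ‖ξ‖) • ξ := fun ξ => by
    rcases eq_or_ne ξ 0 with rfl | h
    · simp [ha₀]
    · exact ha ξ h
  have hmul : ∀ t, φ t / t * t = φ t := fun t => by
    rcases eq_or_ne t 0 with rfl | h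
    · simp [hφ0]
    · exact div_mul_cancel₀ _ h
  intro ξ η hne
  have hr := norm_nonneg ξ
  have hs := norm_nonneg η
  have hp := div_nonneg (hφnonneg _ hr) hr
  have hq := div_nonneg (hφnonneg _ hs) hs
  have hCS := real_inner_le_norm ξ η
  have key : inner ℝ (a ξ - a η) (ξ - η) = (φ ‖ξ‖ - φ ‖η‖) * (‖ξ‖ - ‖η‖)
      + (φ ‖ξ‖ / ‖ξ‖ + φ ‖η‖ / ‖η‖) * (‖ξ‖ * ‖η‖ - inner ℝ ξ η) := by
    rw [ha' ξ, ha' η]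
    simp only [inner_sub_left, inner_sub_right, real_inner_smul_left,
      real_inner_self_eq_norm_sq, real_inner_comm ξ η]
    linear_combination (‖ξ‖ - ‖η‖) * (hmul ‖ξ‖ - hmul ‖η‖)
  rw [key]
  have hcross := mul_nonneg (add_nonneg hp hq) (sub_nonneg.2 hCS)
  rcases lt_trichotomy ‖ξ‖ ‖η‖ with h | h | h
  · have := mul_pos_of_neg_of_neg (sub_neg.2 (hφmono hr hs h)) (sub_neg.2 h)
    linarith
  · have hpos : 0 < ‖ξ‖ := by
      refine hr.lt_of_ne' fun h0 => hne ?_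
      rw [norm_eq_zero.1 h0, norm_eq_zero.1 (h.symm.trans h0)]
    have hφpos : 0 < φ ‖ξ‖ := hφ0 ▸ hφmono Set.self_mem_Ici hr hpos
    have hlt : inner ℝ ξ η < ‖ξ‖ * ‖η‖ := by
      have hsub := norm_sub_sq_real ξ η
      have hd : 0 < ‖ξ - η‖ ^ 2 := pow_pos (norm_pos_iff.2 (sub_ne_zero.2 hne)) 2
      rw [← h] at hsub ⊢
      linarith
    have := mul_pos (add_pos_of_pos_of_nonneg (div_pos hφpos hpos) hq) (sub_pos.2 hlt)
    simpa only [h, sub_self, mul_zero, zero_add] using this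
  · have := mul_pos (sub_pos.2 (hφmono hs hr h)) (sub_pos.2 h)
    linarith
end

section
/- Let n ≥ 1 and let p, c₁, c₂, c₃ be real numbers with p > 1, c₁ > 0, c₂ > 0 and c₃ ≥ 1. Define a : ℝⁿ → ℝⁿ by a(ξ) = c₁ |ξ|^{p−1} log(c₂|ξ| + c₃) ξ, where |·| is the Euclidean norm (so a(0) = 0). Then a is strictly monotone: (a(ξ) − a(η)) · (ξ − η) > 0 for all ξ, η ∈ ℝⁿ with ξ ≠ η, where · denotes the Euclidean inner product. -/
/-- A radial vector field `x ↦ φ ‖x‖ • x` with nonnegative, strictly increasing weight `φ` is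
strictly monotone. -/
theorem inner_radial_sub_pos {E : Type*} [NormedAddCommGroup E] [InnerProductSpace ℝ E]
    {φ : ℝ → ℝ} (hφ : StrictMonoOn φ (Set.Ici 0)) (h0 : 0 ≤ φ 0) {x y : E} (hxy : x ≠ y) :
    0 < inner ℝ (φ ‖x‖ • x - φ ‖y‖ • y) (x - y) := by
  have key : inner ℝ (φ ‖x‖ • x - φ ‖y‖ • y) (x - y) =
      (φ ‖x‖ + φ ‖y‖) / 2 * ‖x - y‖ ^ 2 + (φ ‖x‖ - φ ‖y‖) * (‖x‖ - ‖y‖) * (‖x‖ + ‖y‖) / 2 := by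
    rw [norm_sub_sq_real]
    simp only [inner_sub_left, inner_sub_right, real_inner_smul_left,
      real_inner_self_eq_norm_sq, real_inner_comm x y]
    ring
  have hnonneg (z : E) : 0 ≤ φ ‖z‖ :=
    h0.trans (hφ.monotoneOn Set.self_mem_Ici (norm_nonneg z) (norm_nonneg z))
  have hpos {z : E} (hz : z ≠ 0) : 0 < φ ‖z‖ :=
    h0.trans_lt (hφ Set.self_mem_Ici (norm_nonneg z) (norm_pos_iff.2 hz))
  have hsum : 0 < φ ‖x‖ + φ ‖y‖ := by
    rcases eq_or_ne x 0 with rfl | hx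
    · exact add_pos_of_nonneg_of_pos (hnonneg _) (hpos hxy.symm)
    · exact add_pos_of_pos_of_nonneg (hpos hx) (hnonneg _)
  have hmono : 0 ≤ (φ ‖x‖ - φ ‖y‖) * (‖x‖ - ‖y‖) := by
    rcases le_total ‖x‖ ‖y‖ with h | h
    · exact mul_nonneg_of_nonpos_of_nonpos
        (sub_nonpos.2 (hφ.monotoneOn (norm_nonneg x) (norm_nonneg y) h)) (sub_nonpos.2 h)
    · exact mul_nonneg
        (sub_nonneg.2 (hφ.monotoneOn (norm_nonneg y) (norm_nonneg x) h)) (sub_nonneg.2 h)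
  have hdist : 0 < ‖x - y‖ := norm_pos_iff.2 (sub_ne_zero.2 hxy)
  rw [key]
  positivity

theorem strictMonoOn_mul_rpow_mul_log {q c₁ c₂ c₃ : ℝ} (hq : 0 < q) (hc₁ : 0 < c₁)
    (hc₂ : 0 < c₂) (hc₃ : 1 ≤ c₃) :
    StrictMonoOn (fun t : ℝ => c₁ * t ^ q * Real.log (c₂ * t + c₃)) (Set.Ici 0) := by
  intro s hs t _ hst
  have hs : 0 ≤ s := hs
  have hone : 1 ≤ c₂ * s + c₃ := le_add_of_nonneg_of_le (by positivity) hc₃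
  have hpow : s ^ q < t ^ q := Real.rpow_lt_rpow hs hst hq
  have hlog : Real.log (c₂ * s + c₃) < Real.log (c₂ * t + c₃) :=
    Real.log_lt_log (zero_lt_one.trans_le hone) (by gcongr)
  exact mul_lt_mul'' (mul_lt_mul_of_pos_left hpow hc₁) hlog (by positivity)
    (Real.log_nonneg hone)


/-- The logarithmically perturbed vector field
`a(ξ) = c₁ |ξ|^{p−1} log(c₂|ξ| + c₃) ξ`, with `p > 1`, `c₁, c₂ > 0`, `c₃ ≥ 1`,
is strictly monotone on `ℝⁿ`. -/
theorem logPerturbed_strictMonotone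
    (n : ℕ) (hn : 1 ≤ n) (p c₁ c₂ c₃ : ℝ)
    (hp : 1 < p) (hc₁ : 0 < c₁) (hc₂ : 0 < c₂) (hc₃ : 1 ≤ c₃)
    (a : EuclideanSpace ℝ (Fin n) → EuclideanSpace ℝ (Fin n))
    (ha : ∀ ξ : EuclideanSpace ℝ (Fin n),
      a ξ = (c₁ * ‖ξ‖ ^ (p - 1) * Real.log (c₂ * ‖ξ‖ + c₃)) • ξ) :
    ∀ ξ η : EuclideanSpace ℝ (Fin n), ξ ≠ η →
      0 < inner (𝕜 := ℝ) (a ξ - a η) (ξ - η) := by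
  intro ξ η hne
  rw [ha, ha]
  exact inner_radial_sub_pos
    (strictMonoOn_mul_rpow_mul_log (sub_pos.2 hp) hc₁ hc₂ hc₃)
    (by simp [Real.zero_rpow (sub_pos.2 hp).ne']) hne
end

section
/- Let n ≥ 1 and let p : ℝⁿ → ℝ be measurable and ℤⁿ-periodic (p(x + z) = p(x) for all z ∈ ℤⁿ), with constants 1 < α ≤ β < ∞ such that α ≤ p(x) ≤ β for a.e. x. Define h : ℝⁿ → ℝ by h(ξ) = inf over all ℤⁿ-periodic C^∞ functions v : ℝⁿ → ℝ of ∫_{[0,1]ⁿ} |ξ + ∇v(x)|^{p(x)} / p(x) dx, where |·| is the Euclidean norm. Then h is convex on ℝⁿ. -/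
open MeasureTheory

open Set in
/-- The closed unit cube of Euclidean space is compact. -/
theorem isCompact_euclidean_unitCube (n : ℕ) :
    IsCompact {x : EuclideanSpace ℝ (Fin n) | ∀ i, x i ∈ Icc (0 : ℝ) 1} := by
  have hK : IsCompact (univ.pi fun _ : Fin n => Icc (0 : ℝ) 1) :=
    isCompact_univ_pi fun _ => isCompact_Icc
  have hpre := (EuclideanSpace.equiv (Fin n) ℝ).toHomeomorph.isCompact_preimage.2 hK
  convert hpre using 1
  ext x
  simp [Pi.le_def, forall_and]

/-- The modular `‖w‖ ^ p / p` of a continuous field is integrable on a compact set when the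
exponent `p` is bounded and bounded below by `1`. -/
theorem Continuous.integrableOn_norm_rpow_div {E F : Type*} [TopologicalSpace E]
    [MeasurableSpace E] [OpensMeasurableSpace E] [NormedAddCommGroup F]
    {μ : Measure E} [IsFiniteMeasureOnCompacts μ] {K : Set E} (hK : IsCompact K)
    (hKm : MeasurableSet K) {p : E → ℝ} (hp : Measurable p) {β : ℝ}
    (hpb : ∀ᵐ x ∂μ, 1 ≤ p x ∧ p x ≤ β) {w : E → F} (hw : Continuous w) :
    IntegrableOn (fun x => ‖w x‖ ^ p x / p x) K μ := by
  obtain ⟨C, hC⟩ := hK.exists_bound_of_continuousOn hw.continuousOn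
  refine Measure.integrableOn_of_bounded (M := max C 1 ^ β) hK.measure_lt_top.ne
    ((hw.norm.measurable.pow hp).div hp).aestronglyMeasurable ?_
  filter_upwards [ae_restrict_of_ae hpb, ae_restrict_mem hKm] with x hx hxK
  have hp0 : 0 < p x := by linarith [hx.1]
  have hnum : 0 ≤ ‖w x‖ ^ p x := Real.rpow_nonneg (norm_nonneg _) _
  rw [Real.norm_of_nonneg (div_nonneg hnum hp0.le)]
  calc ‖w x‖ ^ p x / p x ≤ ‖w x‖ ^ p x := div_le_self hnum hx.1
    _ ≤ max C 1 ^ p x :=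
      Real.rpow_le_rpow (norm_nonneg _) ((hC x hxK).trans (le_max_left _ _)) hp0.le
    _ ≤ max C 1 ^ β := Real.rpow_le_rpow_of_exponent_le (le_max_right _ _) hx.2

/-- Convexity of `y ↦ ‖y‖ ^ q / q` for `1 ≤ q`. -/
theorem norm_rpow_div_convex_comb_le {F : Type*} [NormedAddCommGroup F] [NormedSpace ℝ F]
    {q a b : ℝ} (hq : 1 ≤ q) (ha : 0 ≤ a) (hb : 0 ≤ b) (hab : a + b = 1) (y z : F) :
    ‖a • y + b • z‖ ^ q / q ≤ a * (‖y‖ ^ q / q) + b * (‖z‖ ^ q / q) := by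
  have hq0 : 0 < q := by linarith
  have hnorm : ‖a • y + b • z‖ ≤ a * ‖y‖ + b * ‖z‖ := by
    simpa [norm_smul, abs_of_nonneg ha, abs_of_nonneg hb] using norm_add_le (a • y) (b • z)
  have hconv : (a * ‖y‖ + b * ‖z‖) ^ q ≤ a * ‖y‖ ^ q + b * ‖z‖ ^ q := by
    simpa using (convexOn_rpow hq).2 (norm_nonneg y) (norm_nonneg z) ha hb hab
  calc ‖a • y + b • z‖ ^ q / q ≤ (a * ‖y‖ ^ q + b * ‖z‖ ^ q) / q := by
        gcongr
        exact (Real.rpow_le_rpow (norm_nonneg _) hnorm hq0.le).trans hconv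
    _ = a * (‖y‖ ^ q / q) + b * (‖z‖ ^ q / q) := by ring

/-- The gradient of a continuously differentiable function is continuous. -/
theorem ContDiff.continuous_gradient {F : Type*} [NormedAddCommGroup F] [InnerProductSpace ℝ F]
    [CompleteSpace F] {v : F → ℝ} {m : WithTop ℕ∞} (hv : ContDiff ℝ m v) (hm : m ≠ 0) :
    Continuous (gradient v) :=
  (InnerProductSpace.toDual ℝ F).symm.continuous.comp (hv.continuous_fderiv hm)

/-- The gradient is linear on differentiable functions. -/
theorem gradient_linear_comb {F : Type*} [NormedAddCommGroup F] [InnerProductSpace ℝ F]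
    [CompleteSpace F] {v w : F → ℝ} {x : F} (hv : DifferentiableAt ℝ v x)
    (hw : DifferentiableAt ℝ w x) (a b : ℝ) :
    gradient (fun y => a * v y + b * w y) x = a • gradient v x + b • gradient w x := by
  have hd : fderiv ℝ (fun y => a * v y + b * w y) x = a • fderiv ℝ v x + b • fderiv ℝ w x :=
    ((hv.hasFDerivAt.const_mul a).add (hw.hasFDerivAt.const_mul b)).fderiv
  simp [gradient, hd]

/-- The homogenized functional
`h(ξ) = inf { ∫_{[0,1]ⁿ} |ξ + ∇v|^{p(x)}/p(x) dx : v smooth and ℤⁿ-periodic }`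
is convex on `ℝⁿ`. -/
theorem homogenized_functional_convex
    (n : ℕ) (hn : 1 ≤ n) (p : EuclideanSpace ℝ (Fin n) → ℝ)
    (hpmeas : Measurable p)
    (hpper : ∀ x : EuclideanSpace ℝ (Fin n), ∀ z : Fin n → ℤ,
      p (x + (EuclideanSpace.equiv (Fin n) ℝ).symm (fun i => (z i : ℝ))) = p x)
    (α β : ℝ) (hα : 1 < α) (hαβ : α ≤ β)
    (hpbd : ∀ᵐ x : EuclideanSpace ℝ (Fin n), α ≤ p x ∧ p x ≤ β)
    (h : EuclideanSpace ℝ (Fin n) → ℝ)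
    (hdef : ∀ ξ : EuclideanSpace ℝ (Fin n), h ξ =
      sInf { r : ℝ | ∃ v : EuclideanSpace ℝ (Fin n) → ℝ, ContDiff ℝ (⊤ : ℕ∞) v ∧
        (∀ x : EuclideanSpace ℝ (Fin n), ∀ z : Fin n → ℤ,
          v (x + (EuclideanSpace.equiv (Fin n) ℝ).symm (fun i => (z i : ℝ))) = v x) ∧
        r = ∫ x in {x : EuclideanSpace ℝ (Fin n) | ∀ i, x i ∈ Set.Icc (0:ℝ) 1},
              ‖ξ + gradient v x‖ ^ p x / p x }) :
    ConvexOn ℝ Set.univ h := by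
  set K : Set (EuclideanSpace ℝ (Fin n)) := {x | ∀ i, x i ∈ Set.Icc (0:ℝ) 1}
  have hK : IsCompact K := isCompact_euclidean_unitCube n
  have hKm : MeasurableSet K := hK.isClosed.measurableSet
  have hp1 : ∀ᵐ x : EuclideanSpace ℝ (Fin n), 1 ≤ p x ∧ p x ≤ β :=
    hpbd.mono fun x hx => ⟨hα.le.trans hx.1, hx.2⟩
  have hint : ∀ (ξ : EuclideanSpace ℝ (Fin n)) (v : EuclideanSpace ℝ (Fin n) → ℝ),
      ContDiff ℝ (⊤ : ℕ∞) v →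
      IntegrableOn (fun x => ‖ξ + gradient v x‖ ^ p x / p x) K := fun ξ v hv =>
    Continuous.integrableOn_norm_rpow_div hK hKm hpmeas hp1
      (continuous_const.add (hv.continuous_gradient (by simp)))
  have hnonneg : ∀ w : EuclideanSpace ℝ (Fin n) → EuclideanSpace ℝ (Fin n),
      0 ≤ ∫ x in K, ‖w x‖ ^ p x / p x := fun w => by
    refine integral_nonneg_of_ae ?_
    filter_upwards [ae_restrict_of_ae hp1] with x hx
    exact div_nonneg (Real.rpow_nonneg (norm_nonneg _) _) (zero_le_one.trans hx.1)
  have hle : ∀ (ξ : EuclideanSpace ℝ (Fin n)) (v : EuclideanSpace ℝ (Fin n) → ℝ),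
      ContDiff ℝ (⊤ : ℕ∞) v →
      (∀ x : EuclideanSpace ℝ (Fin n), ∀ z : Fin n → ℤ,
        v (x + (EuclideanSpace.equiv (Fin n) ℝ).symm (fun i => (z i : ℝ))) = v x) →
      h ξ ≤ ∫ x in K, ‖ξ + gradient v x‖ ^ p x / p x := fun ξ v hv hper => by
    rw [hdef]
    refine csInf_le ⟨0, ?_⟩ ⟨v, hv, hper, rfl⟩
    rintro r ⟨u, -, -, rfl⟩
    exact hnonneg _
  have hlt : ∀ (ξ : EuclideanSpace ℝ (Fin n)) (ε : ℝ), 0 < ε →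
      ∃ v : EuclideanSpace ℝ (Fin n) → ℝ, ContDiff ℝ (⊤ : ℕ∞) v ∧
      (∀ x : EuclideanSpace ℝ (Fin n), ∀ z : Fin n → ℤ,
        v (x + (EuclideanSpace.equiv (Fin n) ℝ).symm (fun i => (z i : ℝ))) = v x) ∧
      ∫ x in K, ‖ξ + gradient v x‖ ^ p x / p x < h ξ + ε := fun ξ ε hε => by
    have hinf : h ξ < h ξ + ε := lt_add_of_pos_right _ hε
    nth_rw 1 [hdef] at hinf
    obtain ⟨r, ⟨v, hv, hper, rfl⟩, hr⟩ := exists_lt_of_csInf_lt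
      (by exact ⟨_, fun _ => 0, contDiff_const, fun _ _ => rfl, rfl⟩) hinf
    exact ⟨v, hv, hper, hr⟩
  refine ⟨convex_univ, fun ξ _ η _ a b ha hb hab => le_of_forall_pos_le_add fun ε hε => ?_⟩
  obtain ⟨v, hv, hvper, hvlt⟩ := hlt ξ ε hε
  obtain ⟨w, hw, hwper, hwlt⟩ := hlt η ε hε
  have hcomb : ContDiff ℝ (⊤ : ℕ∞) fun x => a * v x + b * w x :=
    (contDiff_const.mul hv).add (contDiff_const.mul hw)
  calc h (a • ξ + b • η)
      ≤ ∫ x in K, ‖a • ξ + b • η + gradient (fun y => a * v y + b * w y) x‖ ^ p x / p x :=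
        hle _ _ hcomb fun x z => by rw [hvper, hwper]
    _ ≤ ∫ x in K, (a * (‖ξ + gradient v x‖ ^ p x / p x) +
          b * (‖η + gradient w x‖ ^ p x / p x)) := by
        refine integral_mono_ae (hint _ _ hcomb)
          (((hint ξ v hv).const_mul a).add ((hint η w hw).const_mul b)) ?_
        filter_upwards [ae_restrict_of_ae hp1] with x hx
        have hgrad := gradient_linear_comb (hv.differentiable (by simp) x)
          (hw.differentiable (by simp) x) a b
        have hsplit : a • ξ + b • η + gradient (fun y => a * v y + b * w y) x =
            a • (ξ + gradient v x) + b • (η + gradient w x) := by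
          rw [hgrad]; module
        rw [hsplit]
        exact norm_rpow_div_convex_comb_le hx.1 ha hb hab _ _
    _ = a * (∫ x in K, ‖ξ + gradient v x‖ ^ p x / p x) +
          b * ∫ x in K, ‖η + gradient w x‖ ^ p x / p x := by
        rw [integral_add ((hint ξ v hv).const_mul a) ((hint η w hw).const_mul b),
          integral_const_mul, integral_const_mul]
    _ ≤ a * (h ξ + ε) + b * (h η + ε) := by gcongr
    _ = a • h ξ + b • h η + ε := by
        simp only [smul_eq_mul]
        linear_combination ε * hab
end
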